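/- For every real a with a < 0, the double integral ∫_a^0 ∫_1^∞ log(y(y−a)(x−1)/(x(x−a)(y−1)))/(x−y)² dy dx converges and equals −4·L(a), where L is the extended Rogers L-function. -/

import Mathlib

open Real

noncomputable def Li2 (x : ℝ) : ℝ := -∫ t in (0:ℝ)..x, Real.log (1 - t) / t

noncomputable def rogersL (x : ℝ) : ℝ :=
  Li2 x + (1/2) * Real.log |x| * Real.log (1 - x)

open MeasureTheory Set Filter Topology

lemma hasDerivAt_log_one_sub {x : ℝ} (hx : x < 1) :
    HasDerivAt (fun t : ℝ => log (1 - t)) (-1 / (1 - x)) x :=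
  ((hasDerivAt_id x).const_sub 1).log (by simp only [id]; linarith)

/-- The Li₂ integrand `log (1 - t) / t` with its removable singularity filled in is
continuous below `1`. -/
lemma continuousAt_update_log_one_sub_div {x : ℝ} (hx : x < 1) :
    ContinuousAt (Function.update (fun t : ℝ => log (1 - t) / t) 0 (-1)) x := by
  rcases eq_or_ne x 0 with rfl | h0
  · rw [continuousAt_update_same]
    have h := (hasDerivAt_log_one_sub (x := 0) one_pos).tendsto_slope
    simpa [slope_fun_def, div_eq_inv_mul] using h
  · rw [continuousAt_update_of_ne h0]
    exact (hasDerivAt_log_one_sub hx).continuousAt.div continuousAt_id h0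

lemma Li2_eq_integral_update (x : ℝ) :
    Li2 x = -∫ t in (0:ℝ)..x, Function.update (fun t : ℝ => log (1 - t) / t) 0 (-1) t := by
  unfold Li2
  congr 1
  refine intervalIntegral.integral_congr_ae ?_
  have h : ∀ᵐ t : ℝ, t ≠ 0 := by simp [ae_iff]
  filter_upwards [h] with t ht _
  rw [Function.update_of_ne ht]

lemma hasDerivAt_Li2_update {x : ℝ} (hx : x < 1) :
    HasDerivAt Li2 (-Function.update (fun t : ℝ => log (1 - t) / t) 0 (-1) x) x := by
  have hc : ContinuousOn (Function.update (fun t : ℝ => log (1 - t) / t) 0 (-1)) (Iio 1) :=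
    fun t ht => (continuousAt_update_log_one_sub_div ht).continuousWithinAt
  have hsub : uIcc 0 x ⊆ Iio (1 : ℝ) := fun t ht => by
    rcases le_total 0 x with h | h
    · rw [uIcc_of_le h] at ht; exact ht.2.trans_lt hx
    · rw [uIcc_of_ge h] at ht; exact ht.2.trans_lt one_pos
  have h := intervalIntegral.integral_hasDerivAt_right (hc.mono hsub).intervalIntegrable
    (hc.stronglyMeasurableAtFilter isOpen_Iio x hx) (continuousAt_update_log_one_sub_div hx)
  rw [show Li2 = fun x => _ from funext Li2_eq_integral_update]
  exact h.neg

lemma continuousAt_log_mul_log_one_sub {x : ℝ} (hx : x < 1) :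
    ContinuousAt (fun t : ℝ => log t * log (1 - t)) x := by
  have h : (fun t : ℝ => log t * log (1 - t)) = fun t =>
      (t * log t) * Function.update (fun t : ℝ => log (1 - t) / t) 0 (-1) t := by
    funext t
    rcases eq_or_ne t 0 with rfl | h0
    · simp
    · rw [Function.update_of_ne h0]; field_simp
  rw [h]
  exact continuous_mul_log.continuousAt.mul (continuousAt_update_log_one_sub_div hx)

lemma rogersL_eq (x : ℝ) : rogersL x = Li2 x + 1 / 2 * (log x * log (1 - x)) := by
  rw [rogersL, log_abs, mul_assoc]

lemma rogersL_zero : rogersL 0 = 0 := by simp [rogersL, Li2]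

lemma continuousAt_rogersL {x : ℝ} (hx : x < 1) : ContinuousAt rogersL x := by
  rw [show rogersL = fun x => _ from funext rogersL_eq]
  exact (hasDerivAt_Li2_update hx).continuousAt.add
    (continuousAt_const.mul (continuousAt_log_mul_log_one_sub hx))

lemma hasDerivAt_rogersL {x : ℝ} (hx : x < 1) (h0 : x ≠ 0) :
    HasDerivAt rogersL (-(1 / 2) * (log (1 - x) / x + log x / (1 - x))) x := by
  rw [show rogersL = fun x => _ from funext rogersL_eq]
  have h := (hasDerivAt_Li2_update hx).add
    (((hasDerivAt_log h0).mul (hasDerivAt_log_one_sub hx)).const_mul (1 / 2))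
  rw [Function.update_of_ne h0] at h
  refine h.congr_deriv ?_
  have : 1 - x ≠ 0 := by linarith
  field_simp
  ring

/-- Landen identity for the Rogers function on the negative axis. -/
lemma rogersL_div_sub_one {a : ℝ} (ha : a < 0) : rogersL (a / (a - 1)) = -rogersL a := by
  have hlt {x : ℝ} (hx : x ≤ 0) : x / (x - 1) < 1 := by
    rw [div_lt_one_of_neg (by linarith)]; linarith
  have hcont : ContinuousOn (fun x => rogersL x + rogersL (x / (x - 1))) (Icc a 0) := by
    intro x hx
    have hx1 : x < 1 := hx.2.trans_lt one_pos
    refine ((continuousAt_rogersL hx1).add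
      (ContinuousAt.comp (f := fun x : ℝ => x / (x - 1)) (continuousAt_rogersL (hlt hx.2))
        ?_)).continuousWithinAt
    exact continuousAt_id.div (by fun_prop) (by linarith)
  have hderiv : ∀ x ∈ Ioo a 0,
      HasDerivAt (fun x => rogersL x + rogersL (x / (x - 1))) 0 x := by
    intro x ⟨_, hx⟩
    have hx1 : x - 1 ≠ 0 := by linarith
    have hx2 : 1 - x ≠ 0 := by linarith
    have hv : HasDerivAt (fun x : ℝ => x / (x - 1)) ((1 * (x - 1) - x * 1) / (x - 1) ^ 2) x :=
      (hasDerivAt_id x).div ((hasDerivAt_id x).sub_const 1) hx1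
    have h := (hasDerivAt_rogersL (by linarith) hx.ne).add
      ((hasDerivAt_rogersL (hlt hx.le) (div_ne_zero hx.ne hx1)).comp x hv)
    refine h.congr_deriv ?_
    have e : 1 - x / (x - 1) = (1 - x)⁻¹ := by
      rw [eq_comm, inv_eq_iff_eq_inv]; field_simp; ring
    have e' : log (x / (x - 1)) = log x - log (1 - x) := by
      rw [log_div hx.ne hx1, ← log_neg_eq_log (x - 1), neg_sub]
    rw [e, e', log_inv, show x - 1 = -(1 - x) by ring]
    have := hx.ne
    field_simp
    ring
  obtain ⟨c, _, hc⟩ := exists_hasDerivAt_eq_slope _ _ ha hcont hderiv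
  rw [eq_comm, div_eq_zero_iff] at hc
  rcases hc with hc | hc
  · simp only [zero_div, rogersL_zero] at hc
    linarith
  · linarith

/-- An antiderivative of `log (y - c) / (y - x) ^ 2` in `y`. -/
noncomputable def logKernelPrimitive (c x y : ℝ) : ℝ :=
  (y - c) * log (y - c) / ((c - x) * (y - x)) - log (y - x) / (c - x)

lemma hasDerivAt_logKernelPrimitive {c x y : ℝ} (hcx : c ≠ x) (hcy : c < y) (hxy : x < y) :
    HasDerivAt (logKernelPrimitive c x) (log (y - c) / (y - x) ^ 2) y := by
  have h1 : c - x ≠ 0 := sub_ne_zero.2 hcx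
  have h2 : y - c ≠ 0 := by linarith
  have h3 : y - x ≠ 0 := by linarith
  have hd (b : ℝ) : HasDerivAt (fun y : ℝ => y - b) 1 y := (hasDerivAt_id y).sub_const b
  have h := (((hd c).mul ((hd c).log h2)).div ((hd x).const_mul (c - x))
    (mul_ne_zero h1 h3)).sub (((hd x).log h3).div_const (c - x))
  refine h.congr_deriv ?_
  simp only [Pi.mul_apply]
  field_simp
  ring

lemma continuousAt_logKernelPrimitive {c x y : ℝ} (hcx : c ≠ x) (hxy : x < y) :
    ContinuousAt (logKernelPrimitive c x) y := by
  have h1 : c - x ≠ 0 := sub_ne_zero.2 hcx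
  have h3 : y - x ≠ 0 := by linarith
  unfold logKernelPrimitive
  have h : ContinuousAt (fun y : ℝ => (y - c) * log (y - c)) y :=
    (continuous_mul_log.comp (continuous_id.sub continuous_const)).continuousAt
  have hd : ContinuousAt (fun y : ℝ => (c - x) * (y - x)) y := by fun_prop
  exact (h.div hd (mul_ne_zero h1 h3)).sub
    (((continuousAt_id.sub continuousAt_const).log h3).div_const _)

lemma tendsto_sub_div_sub_atTop (c x : ℝ) :
    Tendsto (fun y : ℝ => (y - c) / (y - x)) atTop (𝓝 1) := by
  have h : Tendsto (fun y : ℝ => 1 + (x - c) / (y - x)) atTop (𝓝 (1 + 0)) :=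
    tendsto_const_nhds.add (tendsto_const_nhds.div_atTop
      (tendsto_atTop_add_const_right _ (-x) tendsto_id))
  rw [add_zero] at h
  refine h.congr' ?_
  filter_upwards [eventually_gt_atTop x] with y hy
  have : y - x ≠ 0 := by linarith
  field_simp
  ring

lemma tendsto_logKernelPrimitive_atTop {c x : ℝ} (hcx : c ≠ x) :
    Tendsto (logKernelPrimitive c x) atTop (𝓝 0) := by
  have h1 : c - x ≠ 0 := sub_ne_zero.2 hcx
  have hr := tendsto_sub_div_sub_atTop c x
  have hlog : Tendsto (fun y : ℝ => log (y - c) / (y - c)) atTop (𝓝 0) :=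
    (isLittleO_log_id_atTop.tendsto_div_nhds_zero).comp
      (tendsto_atTop_add_const_right _ (-c) tendsto_id)
  have h := ((hr.log one_ne_zero).div_const (c - x)).sub (hlog.mul hr)
  simp only [log_one, zero_div, zero_mul, sub_zero] at h
  refine h.congr' ?_
  filter_upwards [eventually_gt_atTop x, eventually_gt_atTop c] with y hx hc
  have h2 : y - c ≠ 0 := by linarith
  have h3 : y - x ≠ 0 := by linarith
  rw [logKernelPrimitive, log_div h2 h3]
  field_simp
  ring

lemma log_crossRatio_eq {a x y : ℝ} (hax : a < x) (hx : x < 0) (hy : 1 < y) :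
    log (y * (y - a) * (x - 1) / (x * (x - a) * (y - 1))) =
      log (y - 0) + log (y - a) - log (y - 1) - (log x + log (x - a) - log (1 - x)) := by
  have h1 : y ≠ 0 := by linarith
  have h2 : y - a ≠ 0 := by linarith
  have h3 : x - 1 ≠ 0 := by linarith
  have h4 : x - a ≠ 0 := by linarith
  have h5 : y - 1 ≠ 0 := by linarith
  rw [log_div (by positivity) (mul_ne_zero (mul_ne_zero hx.ne h4) h5), log_mul (by positivity) h3,
    log_mul h1 h2, log_mul (mul_ne_zero hx.ne h4) h5, log_mul hx.ne h4, ← log_neg_eq_log (x - 1),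
    neg_sub, sub_zero]
  ring

lemma log_crossRatio_nonneg {a x y : ℝ} (hax : a < x) (hx : x < 0) (hy : 1 < y) :
    0 ≤ log (y * (y - a) * (x - 1) / (x * (x - a) * (y - 1))) := by
  apply log_nonneg
  have hd : x * (x - a) * (y - 1) < 0 :=
    mul_neg_of_neg_of_pos (mul_neg_of_neg_of_pos hx (by linarith)) (by linarith)
  rw [one_le_div_of_neg hd]
  have h : x * (x - a) * (y - 1) - y * (y - a) * (x - 1) =
      (y - x) * ((1 - x) * (y - 1) + (1 - a)) := by ring
  have : 0 ≤ (y - x) * ((1 - x) * (y - 1) + (1 - a)) :=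
    mul_nonneg (by linarith) (add_nonneg (mul_nonneg (by linarith) (by linarith)) (by linarith))
  linarith

lemma integral_log_crossRatio_right {a x : ℝ} (hax : a < x) (hx : x < 0) :
    IntegrableOn (fun y : ℝ =>
        log (y * (y - a) * (x - 1) / (x * (x - a) * (y - 1))) / (x - y) ^ 2) (Ioi 1) ∧
      ∫ y in Ioi (1 : ℝ), log (y * (y - a) * (x - 1) / (x * (x - a) * (y - 1))) / (x - y) ^ 2 =
        -log (1 - x) / x - log x / (1 - x) -
          (log (1 - x) - log (1 - a)) / (x - a) - (log (x - a) - log (1 - a)) / (1 - x) := by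
  set g := log x + log (x - a) - log (1 - x) with hg
  set F : ℝ → ℝ := fun y => logKernelPrimitive 0 x y + logKernelPrimitive a x y -
    logKernelPrimitive 1 x y + g / (y - x) with hF
  have hx1 : (1 : ℝ) ≠ x := by linarith
  have hcont : ContinuousWithinAt F (Ici 1) 1 := by
    have hx' : x < 1 := by linarith
    refine ContinuousAt.continuousWithinAt ?_
    exact (((continuousAt_logKernelPrimitive hx.ne' hx').add
      (continuousAt_logKernelPrimitive hax.ne hx')).sub
      (continuousAt_logKernelPrimitive hx1 hx')).add
      (continuousAt_const.div (by fun_prop) (by linarith))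
  have hderiv : ∀ y ∈ Ioi (1 : ℝ), HasDerivAt F
      (log (y * (y - a) * (x - 1) / (x * (x - a) * (y - 1))) / (x - y) ^ 2) y := by
    intro y (hy : 1 < y)
    have hxy : x < y := by linarith
    have hyx : y - x ≠ 0 := by linarith
    have h := (((hasDerivAt_logKernelPrimitive hx.ne' (by linarith : 0 < y) hxy).add
      (hasDerivAt_logKernelPrimitive hax.ne (by linarith : a < y) hxy)).sub
      (hasDerivAt_logKernelPrimitive hx1 hy hxy)).add
      ((hasDerivAt_const y g).div ((hasDerivAt_id y).sub_const x) hyx)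
    refine h.congr_deriv ?_
    rw [log_crossRatio_eq hax hx hy, ← hg, ← neg_sub y x, neg_sq]
    simp only [id]
    field_simp
    ring
  have hnonneg : ∀ y ∈ Ioi (1 : ℝ),
      0 ≤ log (y * (y - a) * (x - 1) / (x * (x - a) * (y - 1))) / (x - y) ^ 2 :=
    fun y hy => div_nonneg (log_crossRatio_nonneg hax hx hy) (sq_nonneg _)
  have hlim : Tendsto F atTop (𝓝 0) := by
    have h := (((tendsto_logKernelPrimitive_atTop hx.ne').add
      (tendsto_logKernelPrimitive_atTop hax.ne)).sub
      (tendsto_logKernelPrimitive_atTop hx1)).add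
      ((tendsto_const_nhds (x := g)).div_atTop
        (tendsto_atTop_add_const_right atTop (-x) tendsto_id))
    simpa only [add_zero, sub_zero, id, ← sub_eq_add_neg] using h
  refine ⟨integrableOn_Ioi_deriv_of_nonneg hcont hderiv hnonneg hlim, ?_⟩
  rw [integral_Ioi_of_hasDerivAt_of_nonneg hcont hderiv hnonneg hlim]
  have h2 : x - a ≠ 0 := by linarith
  have h3 : 1 - x ≠ 0 := by linarith
  have h4 := hx.ne
  simp only [hF, hg, logKernelPrimitive, sub_zero, log_one, sub_self, zero_mul, mul_zero,
    zero_div, zero_sub]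
  rw [← neg_sub x a]
  field_simp
  ring

lemma integral_integral_log_crossRatio {a : ℝ} (ha : a < 0)
    {I : ℝ → ℝ} (hI : ∀ x ∈ Ioo a 0, I x = -log (1 - x) / x - log x / (1 - x) -
      (log (1 - x) - log (1 - a)) / (x - a) - (log (x - a) - log (1 - a)) / (1 - x))
    (hI0 : ∀ x ∈ Ioo a 0, 0 ≤ I x) :
    IntegrableOn I (Ioo a 0) ∧ ∫ x in Ioo a 0, I x = -4 * rogersL a := by
  set G : ℝ → ℝ := fun x => 2 * rogersL x + 2 * rogersL ((x - a) / (1 - a)) with hG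
  have ha1 : 0 < 1 - a := by linarith
  have hw {x : ℝ} (hx : x ≤ 0) : (x - a) / (1 - a) < 1 := by
    rw [div_lt_one ha1]; linarith
  have hcont : ContinuousOn G (Icc a 0) := by
    intro x hx
    refine ContinuousAt.continuousWithinAt ?_
    exact (continuousAt_const.mul (continuousAt_rogersL (hx.2.trans_lt one_pos))).add
      (continuousAt_const.mul (ContinuousAt.comp (f := fun x : ℝ => (x - a) / (1 - a))
        (continuousAt_rogersL (hw hx.2)) (by fun_prop)))
  have hderiv : ∀ x ∈ Ioo a 0, HasDerivAt G (I x) x := by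
    intro x hx
    have hxa : x - a ≠ 0 := by linarith [hx.1]
    have hx1 : 1 - x ≠ 0 := by linarith [hx.2]
    have hx0 := hx.2.ne
    have h := ((hasDerivAt_rogersL (by linarith [hx.2]) hx0).const_mul 2).add
      (((hasDerivAt_rogersL (hw hx.2.le) (div_ne_zero hxa ha1.ne')).comp x
        (((hasDerivAt_id x).sub_const a).div_const (1 - a))).const_mul 2)
    refine h.congr_deriv ?_
    have e : 1 - (x - a) / (1 - a) = (1 - x) / (1 - a) := by field_simp; ring
    rw [hI x hx, e, log_div hxa ha1.ne', log_div hx1 ha1.ne']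
    field_simp
    ring
  have hInt : IntegrableOn I (Ioc a 0) :=
    intervalIntegral.integrableOn_deriv_of_nonneg hcont hderiv hI0
  refine ⟨hInt.mono_set Ioo_subset_Ioc_self, ?_⟩
  rw [← integral_Ioc_eq_integral_Ioo, ← intervalIntegral.integral_of_le ha.le,
    intervalIntegral.integral_eq_sub_of_hasDerivAt_of_le ha.le hcont hderiv
      ((intervalIntegrable_iff_integrableOn_Ioc_of_le ha.le).2 hInt)]
  have e : (0 - a) / (1 - a) = a / (a - 1) := by
    rw [← neg_div_neg_eq]; congr 1 <;> ring
  simp only [hG, e, rogersL_div_sub_one ha, sub_self, zero_div, rogersL_zero]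
  ring

theorem double_integral_rogersL (a : ℝ) (ha : a < 0) :
    MeasureTheory.IntegrableOn
      (fun p : ℝ × ℝ =>
        Real.log (p.2 * (p.2 - a) * (p.1 - 1) / (p.1 * (p.1 - a) * (p.2 - 1))) / (p.1 - p.2) ^ 2)
      (Set.Ioo a 0 ×ˢ Set.Ioi (1 : ℝ)) ∧
    ∫ p in Set.Ioo a 0 ×ˢ Set.Ioi (1 : ℝ),
        Real.log (p.2 * (p.2 - a) * (p.1 - 1) / (p.1 * (p.1 - a) * (p.2 - 1))) / (p.1 - p.2) ^ 2
      = -4 * rogersL a := by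
  have hnonneg {x y : ℝ} (hx : x ∈ Ioo a 0) (hy : y ∈ Ioi (1 : ℝ)) :
      0 ≤ log (y * (y - a) * (x - 1) / (x * (x - a) * (y - 1))) / (x - y) ^ 2 :=
    div_nonneg (log_crossRatio_nonneg hx.1 hx.2 hy) (sq_nonneg _)
  obtain ⟨hInt, heq⟩ := integral_integral_log_crossRatio ha
    (fun x hx => (integral_log_crossRatio_right hx.1 hx.2).2)
    (fun x hx => setIntegral_nonneg measurableSet_Ioi fun y hy => hnonneg hx hy)
  have hI : IntegrableOn (fun p : ℝ × ℝ =>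
      log (p.2 * (p.2 - a) * (p.1 - 1) / (p.1 * (p.1 - a) * (p.2 - 1))) / (p.1 - p.2) ^ 2)
      (Ioo a 0 ×ˢ Ioi (1 : ℝ)) := by
    rw [IntegrableOn, Measure.volume_eq_prod, ← Measure.prod_restrict, integrable_prod_iff]
    · refine ⟨?_, hInt.congr_fun (fun x hx => ?_) measurableSet_Ioo⟩
      · filter_upwards [ae_restrict_mem measurableSet_Ioo] with x hx
        exact (integral_log_crossRatio_right hx.1 hx.2).1
      · exact setIntegral_congr_fun measurableSet_Ioi
          fun y hy => (norm_of_nonneg (hnonneg hx hy)).symm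
    · exact Measurable.aestronglyMeasurable (by fun_prop)
  refine ⟨hI, ?_⟩
  rw [Measure.volume_eq_prod] at hI ⊢
  rw [setIntegral_prod _ hI, heq]
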